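/- Let g be a finite-dimensional Lie algebra over k of characteristic zero and A = U(g). The complex P_• with P_n = A ⊗ Λⁿg ⊗ A and the Koszul-type differential ∂ (including the Lie bracket term) is a resolution of A as an A-bimodule: H₀(P_•) = A via the multiplication map a ⊗ 1 ⊗ b ↦ ab, and Hₙ(P_•) = 0 for n > 0. -/

import Mathlib

open scoped TensorProduct

set_option synthInstance.maxHeartbeats 1000000
set_option maxHeartbeats 2000000

variable (k : Type*) {g : Type*} [Field k] [AddCommGroup g] [Module k g]

/-- The wedge `x₁ ∧ … ∧ xₙ` as an element of the `n`-th exterior power `⋀[k]^n g`. -/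
noncomputable def wedgePow (n : ℕ) (x : Fin n → g) : ⋀[k]^n g :=
  ⟨ExteriorAlgebra.ιMulti k n x,
    ExteriorAlgebra.ιMulti_range k n (Set.mem_range_self _)⟩


namespace CEabs

/-- Formal properties of the operators on the complex (Cartan calculus and filtration). -/
structure Data (k g : Type*) [Field k] [LieRing g] [LieAlgebra k g] {m : ℕ}
    (b : Module.Basis (Fin m) k g)
    (P : ℕ → Type*) [∀ n, AddCommGroup (P n)] [∀ n, Module k (P n)]
    (d : ∀ n, P (n + 1) →ₗ[k] P n) (ε : ∀ n, g →ₗ[k] P n →ₗ[k] P (n + 1))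
    (L : ∀ n, g → P n →ₗ[k] P n)
    (Δ : ∀ n, Fin m → P n →ₗ[k] P n) (G : ∀ n, ℕ → Submodule k (P n)) : Prop where
  d_zero : ∀ x z, d 0 (ε 0 x z) = - L 0 x z
  d_succ : ∀ n x z, d (n + 1) (ε (n + 1) x z) = - ε n x (d n z) - L (n + 1) x z
  L_ε : ∀ n x y z, L (n + 1) x (ε n y z) = ε n y (L n x z) + ε n ⁅x, y⁆ z
  L_L : ∀ n x y z, L n x (L n y z) - L n y (L n x z) = L n ⁅x, y⁆ z
  G_span : ∀ n q (S : Submodule k (P (n + 1))), (∀ x, ∀ z ∈ G n q, ε n x z ∈ S) → G (n + 1) q ≤ S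
  G_top : ∀ n z, ∃ q, z ∈ G n q
  G_zero : ∀ n, G n 0 = ⊥
  ε_mem : ∀ n x q, ∀ z ∈ G n q, ε n x z ∈ G (n + 1) q
  ε_ε : ∀ n x y z, ε (n + 1) x (ε n y z) = - ε (n + 1) y (ε n x z)
  Δ_ε : ∀ n i y z, Δ (n + 1) i (ε n y z) = ε n y (Δ n i z)
  Δ_L : ∀ n i x q, ∀ z ∈ G n (q + 1), Δ n i (L n x z) - L n x (Δ n i z) - (b.repr x i) • z ∈ G n q
  euler : ∀ n q, ∀ z ∈ G n (q + 1), ∑ i, L n (b i) (Δ n i z) - (q : k) • z ∈ G n q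

variable {k g : Type*} [Field k] [LieRing g] [LieAlgebra k g] {m : ℕ}
    {b : Module.Basis (Fin m) k g}
    {P : ℕ → Type*} [∀ n, AddCommGroup (P n)] [∀ n, Module k (P n)]
    {d : ∀ n, P (n + 1) →ₗ[k] P n} {ε : ∀ n, g →ₗ[k] P n →ₗ[k] P (n + 1)}
    {L : ∀ n, g → P n →ₗ[k] P n}
    {Δ : ∀ n, Fin m → P n →ₗ[k] P n} {G : ∀ n, ℕ → Submodule k (P n)}

lemma ext_ε (H : Data k g b P d ε L Δ G) {W : Type*} [AddCommGroup W] [Module k W] (n) (f f' : P (n + 1) →ₗ[k] W)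
    (h : ∀ x z, f (ε n x z) = f' (ε n x z)) (z) : f z = f' z := by
  obtain ⟨q, hq⟩ := H.G_top (n + 1) z
  have := H.G_span n q (LinearMap.ker (f - f')) (by
    intro x z _
    simp [h]) hq
  simpa [sub_eq_zero] using this

lemma d_L (H : Data k g b P d ε L Δ G) (n x z) : d n (L (n + 1) x z) = L n x (d n z) := by
  induction n with
  | zero =>
    refine ext_ε H 0 (d 0 ∘ₗ L 1 x) (L 0 x ∘ₗ d 0) ?_ z
    intro y z
    have := H.L_L 0 x y z
    simp only [LinearMap.comp_apply, H.L_ε, map_add, H.d_zero, map_neg, ← this]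
    abel
  | succ n ih =>
    refine ext_ε H (n + 1) (d (n + 1) ∘ₗ L (n + 2) x) (L (n + 1) x ∘ₗ d (n + 1)) ?_ z
    intro y z
    have := H.L_L (n + 1) x y z
    simp only [LinearMap.comp_apply, H.L_ε, map_add, H.d_succ, map_neg, map_sub, ← this, ih]
    abel

lemma d_d (H : Data k g b P d ε L Δ G) (n z) : d n (d (n + 1) z) = 0 := by
  induction n with
  | zero =>
    refine ext_ε H 1 (d 0 ∘ₗ d 1) 0 ?_ z
    intro y z
    simp only [LinearMap.comp_apply, H.d_succ, map_sub, map_neg, H.d_zero, d_L H,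
      LinearMap.zero_apply]
    abel
  | succ n ih =>
    refine ext_ε H (n + 2) (d (n + 1) ∘ₗ d (n + 2)) 0 ?_ z
    intro y z
    simp only [LinearMap.comp_apply, H.d_succ, map_sub, map_neg, d_L H, ih,
      LinearMap.zero_apply, map_zero]
    abel

lemma ε_sum (H : Data k g b P d ε L Δ G) (n y z) : ∑ i, ε n (b i) ((b.repr y i) • z) = ε n y z := by
  conv_rhs => rw [← b.sum_repr y]
  simp only [map_sum, map_smul, LinearMap.sum_apply, LinearMap.smul_apply]

lemma ε_sum' (H : Data k g b P d ε L Δ G) (n y z) : ∑ i, (b.repr y i) • ε n (b i) z = ε n y z := by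
  conv_rhs => rw [← b.sum_repr y]
  simp only [map_sum, map_smul, LinearMap.sum_apply, LinearMap.smul_apply]

lemma key (H : Data k g b P d ε L Δ G) (n q) : ∀ z ∈ G (n + 1) (q + 1),
    ∑ i, ε n (b i) (Δ n i (d n z) - d n (Δ (n + 1) i z)) + ((n : k) + 1) • z ∈ G (n + 1) q := by
  induction n with
  | zero =>
    let f : P 1 →ₗ[k] P 1 := ∑ i, ε 0 (b i) ∘ₗ (Δ 0 i ∘ₗ d 0 - d 0 ∘ₗ Δ 1 i) +
      (((0 : ℕ) : k) + 1) • LinearMap.id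
    have hf : ∀ z, f z = ∑ i, ε 0 (b i) (Δ 0 i (d 0 z) - d 0 (Δ 1 i z)) +
        (((0 : ℕ) : k) + 1) • z := by
      intro z
      simp only [f, LinearMap.add_apply, LinearMap.sum_apply]
      rfl
    intro z hz
    rw [← hf]
    refine H.G_span 0 (q + 1) ((G 1 q).comap f) ?_ hz
    intro y w hw
    rw [Submodule.mem_comap, hf]
    have h1 : ∑ i, ε 0 (b i) (Δ 0 i (L 0 y w) - L 0 y (Δ 0 i w) - (b.repr y i) • w) ∈ G 1 q :=
      Submodule.sum_mem _ fun i _ => H.ε_mem _ _ _ _ (H.Δ_L 0 i y q w hw)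
    have h2 := neg_mem h1
    convert h2 using 1
    simp only [H.Δ_ε, H.d_zero, map_sub (ε 0 _), Finset.sum_sub_distrib, ε_sum H, map_neg,
      Finset.sum_neg_distrib, Nat.cast_zero, zero_add, one_smul]
    abel
  | succ n ih =>
    let f : P (n + 2) →ₗ[k] P (n + 2) :=
      ∑ i, ε (n + 1) (b i) ∘ₗ (Δ (n + 1) i ∘ₗ d (n + 1) - d (n + 1) ∘ₗ Δ (n + 2) i) +
      (((n + 1 : ℕ) : k) + 1) • LinearMap.id
    have hf : ∀ z, f z = ∑ i, ε (n + 1) (b i) (Δ (n + 1) i (d (n + 1) z) - d (n + 1) (Δ (n + 2) i z)) +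
        (((n + 1 : ℕ) : k) + 1) • z := by
      intro z
      simp only [f, LinearMap.add_apply, LinearMap.sum_apply]
      rfl
    intro z hz
    rw [← hf]
    refine H.G_span (n + 1) (q + 1) ((G (n + 2) q).comap f) ?_ hz
    intro y w hw
    rw [Submodule.mem_comap, hf]
    have h1 : ∑ i, ε (n + 1) (b i) (Δ (n + 1) i (L (n + 1) y w) - L (n + 1) y (Δ (n + 1) i w)
        - (b.repr y i) • w) ∈ G (n + 2) q :=
      Submodule.sum_mem _ fun i _ => H.ε_mem _ _ _ _ (H.Δ_L (n + 1) i y q w hw)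
    have h3 := H.ε_mem (n + 1) y q _ (ih w hw)
    have h2 := sub_mem h3 h1
    convert h2 using 1
    have e : ∀ i, ε (n + 1) (b i) (Δ (n + 1) i (d (n + 1) (ε (n + 1) y w)) -
        d (n + 1) (Δ (n + 2) i (ε (n + 1) y w))) =
        ε (n + 1) y (ε n (b i) (Δ n i (d n w) - d n (Δ (n + 1) i w))) -
        ε (n + 1) (b i) (Δ (n + 1) i (L (n + 1) y w) - L (n + 1) y (Δ (n + 1) i w)) := by
      intro i
      simp only [H.Δ_ε, H.d_succ, map_sub, map_neg, H.ε_ε n y (b i)]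
      abel
    simp only [e, map_sub (ε (n + 1) _), map_add, Finset.sum_sub_distrib, ε_sum' H, map_sum,
      map_smul, Nat.cast_add, Nat.cast_one, add_smul, one_smul]
    abel

lemma homotopy_zero (H : Data k g b P d ε L Δ G) (q) (z) (hz : z ∈ G 0 (q + 1)) :
    ∃ w, d 0 w + (q : k) • z ∈ G 0 q := by
  refine ⟨∑ i, ε 0 (b i) (Δ 0 i z), ?_⟩
  have := neg_mem (H.euler 0 q z hz)
  simp only [map_sum, H.d_zero]
  convert this using 1
  rw [Finset.sum_neg_distrib]
  abel

lemma homotopy_succ (H : Data k g b P d ε L Δ G) (n q) (z) (hz : z ∈ G (n + 1) (q + 1)) (hdz : d n z = 0) :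
    ∃ w, d (n + 1) w + ((n : k) + 1 + q) • z ∈ G (n + 1) q := by
  refine ⟨∑ i, ε (n + 1) (b i) (Δ (n + 1) i z), ?_⟩
  have h1 := neg_mem (H.euler (n + 1) q z hz)
  have h2 := key H n q z hz
  have := add_mem h1 h2
  simp only [map_sum, H.d_succ]
  convert this using 1
  simp only [hdz, map_zero, zero_sub, map_neg, add_smul, Finset.sum_sub_distrib,
    Finset.sum_neg_distrib]
  abel

lemma exact_aux (H : Data k g b P d ε L Δ G) [CharZero k] (n q) : ∀ z ∈ G (n + 1) q, d n z = 0 → ∃ w, d (n + 1) w = z := by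
  induction q with
  | zero =>
    intro z hz _
    rw [H.G_zero, Submodule.mem_bot] at hz
    exact ⟨0, by simp [hz]⟩
  | succ q ih =>
    intro z hz hdz
    obtain ⟨w, hw⟩ := homotopy_succ H n q z hz hdz
    obtain ⟨w', hw'⟩ := ih _ hw (by simp [d_d H, hdz])
    have hne : ((n : k) + 1 + q) ≠ 0 := by
      have : ((n + 1 + q : ℕ) : k) ≠ 0 := Nat.cast_ne_zero.2 (by omega)
      simpa using this
    refine ⟨((n : k) + 1 + q)⁻¹ • (w' - w), ?_⟩
    rw [map_smul, map_sub, hw', add_sub_cancel_left, smul_smul, inv_mul_cancel₀ hne, one_smul]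

lemma exact_succ (H : Data k g b P d ε L Δ G) [CharZero k] (n) : Function.Exact (d (n + 1)) (d n) := by
  intro z
  constructor
  · intro hz
    obtain ⟨q, hq⟩ := H.G_top _ z
    exact exact_aux H n q z hq hz
  · rintro ⟨w, rfl⟩
    exact d_d H n w

lemma reduce_zero (H : Data k g b P d ε L Δ G) [CharZero k] (q) : ∀ z ∈ G 0 (q + 1), ∃ w, z - d 0 w ∈ G 0 1 := by
  induction q with
  | zero =>
    intro z hz
    exact ⟨0, by simpa using hz⟩
  | succ q ih =>
    intro z hz
    obtain ⟨w, hw⟩ := homotopy_zero H (q + 1) z hz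
    obtain ⟨w', hw'⟩ := ih _ hw
    have hne : ((q + 1 : ℕ) : k) ≠ 0 := Nat.cast_ne_zero.2 (by omega)
    refine ⟨((q + 1 : ℕ) : k)⁻¹ • (w' - w), ?_⟩
    have := Submodule.smul_mem _ ((q + 1 : ℕ) : k)⁻¹ hw'
    convert this using 1
    rw [map_smul, map_sub, smul_sub, smul_sub, smul_add, smul_smul, inv_mul_cancel₀ hne, one_smul]
    abel

end CEabs

namespace PBW
open MvPolynomial Finsupp

variable {k : Type*} [Field k] {m : ℕ}

/-- least letter -/
noncomputable def mn (M : Fin m →₀ ℕ) (h : M ≠ 0) : Fin m :=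
  M.support.min' (Finsupp.support_nonempty_iff.2 h)

lemma mn_spec (M : Fin m →₀ ℕ) (h : M ≠ 0) : M = single (mn M h) 1 + (M - single (mn M h) 1) := by
  have h1 : mn M h ∈ M.support := Finset.min'_mem _ _
  rw [add_tsub_cancel_of_le]
  rw [Finsupp.single_le_iff]
  rw [Finsupp.mem_support_iff] at h1
  omega

lemma mn_le (M : Fin m →₀ ℕ) (h : M ≠ 0) (l) (hl : l ∈ M.support) : mn M h ≤ l :=
  Finset.min'_le _ _ hl

lemma mn_add (j : Fin m) (N : Fin m →₀ ℕ) (hN : ∀ l ∈ N.support, j ≤ l) (h : single j 1 + N ≠ 0) :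
    mn (single j 1 + N) h = j := by
  apply le_antisymm
  · apply mn_le
    simp
  · unfold mn
    rw [Finset.le_min'_iff]
    intro l hl
    by_cases hlj : j = l
    · exact hlj.le
    · apply hN
      simp only [Finsupp.mem_support_iff, Finsupp.add_apply] at hl ⊢
      rwa [Finsupp.single_eq_of_ne (Ne.symm hlj), zero_add] at hl

lemma mn_sub (j : Fin m) (N : Fin m →₀ ℕ) : (single j 1 + N) - single j 1 = N := by
  exact add_tsub_cancel_left _ _

lemma ne_zero_add (j : Fin m) (N : Fin m →₀ ℕ) : single j 1 + N ≠ 0 := by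
  intro h
  have := DFunLike.congr_fun h j
  simp at this

lemma deg_add (j : Fin m) (N : Fin m →₀ ℕ) : (single j 1 + N).degree = N.degree + 1 := by
  simp [add_comm]

/-- induction on (degree, letter) -/
lemma meas_aux (a b i j m : ℕ) (h : a < b) (hj : j < m) : a * m + j < b * m + i := by
  nlinarith

/-- action of a letter on a monomial -/
noncomputable def act (c : Fin m → Fin m → Fin m → k) (i : Fin m) (M : Fin m →₀ ℕ) :
    MvPolynomial (Fin m) k :=
  if h : ∃ h0 : M ≠ 0, mn M h0 < i then
    (basisMonomials (Fin m) k).constr k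
      (fun K => if hK : K.degree ≤ M.degree then act c (mn M h.1) K else 0)
        (act c i (M - single (mn M h.1) 1)) +
      ∑ l, c i (mn M h.1) l • act c l (M - single (mn M h.1) 1)
  else monomial (single i 1 + M) 1
termination_by M.degree * m + i
decreasing_by
  · obtain ⟨h0, h1⟩ := h
    have := Nat.mul_le_mul_right m hK
    have : (mn M h0 : ℕ) < i := h1
    omega
  · obtain ⟨h0, h1⟩ := h
    have := deg_add (mn M h0) (M - single (mn M h0) 1)
    rw [← mn_spec] at this
    apply meas_aux _ _ _ _ _ _ i.2
    omega
  · obtain ⟨h0, h1⟩ := h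
    have := deg_add (mn M h0) (M - single (mn M h0) 1)
    rw [← mn_spec] at this
    apply meas_aux _ _ _ _ _ _ l.2
    omega

/-- polynomials of degree `< q` -/
noncomputable def Vf (k : Type*) [Field k] (m q : ℕ) : Submodule k (MvPolynomial (Fin m) k) :=
  Submodule.span k {v | ∃ M : Fin m →₀ ℕ, M.degree < q ∧ v = monomial M 1}

lemma mono_mem {M : Fin m →₀ ℕ} {q : ℕ} (h : M.degree < q) : (monomial M (1 : k)) ∈ Vf k m q :=
  Submodule.subset_span ⟨M, h, rfl⟩

lemma Vf_mono {p q : ℕ} (h : p ≤ q) : Vf k m p ≤ Vf k m q := by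
  apply Submodule.span_mono
  rintro v ⟨M, hM, rfl⟩
  exact ⟨M, by omega, rfl⟩

lemma Vf_map {W : Type*} [AddCommGroup W] [Module k W] {q : ℕ}
    (f : MvPolynomial (Fin m) k →ₗ[k] W) (S : Submodule k W)
    (h : ∀ M : Fin m →₀ ℕ, M.degree < q → f (monomial M 1) ∈ S) :
    ∀ v ∈ Vf k m q, f v ∈ S := by
  intro v hv
  have : Vf k m q ≤ S.comap f := by
    apply Submodule.span_le.2
    rintro v ⟨M, hM, rfl⟩
    exact h M hM
  exact this hv

lemma Vf_eq {W : Type*} [AddCommGroup W] [Module k W] {q : ℕ}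
    (f f' : MvPolynomial (Fin m) k →ₗ[k] W)
    (h : ∀ M : Fin m →₀ ℕ, M.degree < q → f (monomial M 1) = f' (monomial M 1)) :
    ∀ v ∈ Vf k m q, f v = f' v := by
  intro v hv
  have := Vf_map (f - f') ⊥ (q := q) (by
    intro M hM
    simp [h M hM]) v hv
  simpa [sub_eq_zero] using this

lemma exists_Vf (v : MvPolynomial (Fin m) k) : ∃ q, v ∈ Vf k m q := by
  induction v using MvPolynomial.induction_on' with
  | monomial M a =>
    refine ⟨M.degree + 1, ?_⟩
    have : monomial M a = a • monomial M (1 : k) := by simp [smul_monomial]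
    rw [this]
    exact Submodule.smul_mem _ _ (mono_mem (by omega))
  | add p q hp hq =>
    obtain ⟨a, ha⟩ := hp
    obtain ⟨b, hb⟩ := hq
    exact ⟨max a b, add_mem (Vf_mono (le_max_left _ _) ha) (Vf_mono (le_max_right _ _) hb)⟩

lemma X_mul_mono (i : Fin m) (M : Fin m →₀ ℕ) :
    (X i : MvPolynomial (Fin m) k) * monomial M 1 = monomial (single i 1 + M) 1 := by
  simp [X, monomial_mul]

/-- the linear extension -/
noncomputable def E (c : Fin m → Fin m → Fin m → k) (i : Fin m) :
    MvPolynomial (Fin m) k →ₗ[k] MvPolynomial (Fin m) k :=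
  (basisMonomials (Fin m) k).constr k (act c i)

lemma constr_mono {W : Type*} [AddCommGroup W] [Module k W] (f : (Fin m →₀ ℕ) → W) (M) :
    (basisMonomials (Fin m) k).constr k f (monomial M 1) = f M := by
  have := (basisMonomials (Fin m) k).constr_basis k f M
  rwa [coe_basisMonomials] at this

lemma E_mono (c : Fin m → Fin m → Fin m → k) (i : Fin m) (M) :
    E c i (monomial M 1) = act c i M := constr_mono _ _

lemma meas_ind {Q : Fin m → (Fin m →₀ ℕ) → Prop}
    (H : ∀ i M, (∀ j N, N.degree < M.degree → Q j N) →
      (∀ j N, N.degree ≤ M.degree → j < i → Q j N) → Q i M) (i M) : Q i M := by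
  have key : ∀ n : ℕ, ∀ i : Fin m, ∀ M : Fin m →₀ ℕ, M.degree * m + i = n → Q i M := by
    intro n
    induction n using Nat.strong_induction_on with
    | _ n ih =>
      intro i M hn
      apply H
      · intro j N hN
        exact ih _ (by rw [← hn]; exact meas_aux _ _ _ _ _ hN j.2) j N rfl
      · intro j N hN hj
        refine ih _ ?_ j N rfl
        have := Nat.mul_le_mul_right m hN
        have : (j : ℕ) < i := hj
        omega
  exact key _ i M rfl

lemma act_deg (c : Fin m → Fin m → Fin m → k) (i M) :
    act c i M - monomial (single i 1 + M) 1 ∈ Vf k m (M.degree + 1) := by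
  induction i, M using meas_ind with
  | _ i M h1 h2 =>
  have h1' : ∀ j N, N.degree < M.degree → act c j N ∈ Vf k m (M.degree + 1) := by
    intro j N hN
    have := Vf_mono (show N.degree + 1 ≤ M.degree + 1 by omega) (h1 j N hN)
    have h3 : monomial (single j 1 + N) (1 : k) ∈ Vf k m (M.degree + 1) :=
      mono_mem (by rw [deg_add]; omega)
    simpa using add_mem this h3
  rw [act]
  split_ifs with h
  · have hlt := h.2
    have hM := mn_spec M h.1
    have hN := deg_add (mn M h.1) (M - single (mn M h.1) 1)
    rw [← mn_spec] at hN
    generalize mn M h.1 = j at hlt hM hN ⊢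
    generalize M - single j 1 = N at hM hN ⊢
    set F := (basisMonomials (Fin m) k).constr k
      (fun K => if hK : K.degree ≤ M.degree then act c j K else 0) with hF
    have hw := h1 i N (by omega)
    have e1 : act c i N = (act c i N - monomial (single i 1 + N) 1) + monomial (single i 1 + N) 1 := by
      ring
    rw [e1, map_add]
    have a1 : F (act c i N - monomial (single i 1 + N) 1) ∈ Vf k m (M.degree + 1) := by
      refine Vf_map F _ ?_ _ hw
      intro K hK
      rw [hF, constr_mono, dif_pos (by omega)]
      exact h1' _ _ (by omega)
    have a2 : F (monomial (single i 1 + N) 1) - monomial (single i 1 + M) 1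
        ∈ Vf k m (M.degree + 1) := by
      rw [hF, constr_mono, dif_pos (by rw [deg_add]; omega)]
      have := h2 j (single i 1 + N) (by rw [deg_add]; omega) hlt
      rw [deg_add, ← hN] at this
      have e : single i 1 + M = single j 1 + (single i 1 + N) := by
        rw [hM]
        exact add_left_comm _ _ _
      rw [e]
      exact this
    have a3 : ∑ l, c i j l • act c l N ∈ Vf k m (M.degree + 1) :=
      Submodule.sum_mem _ fun l _ => Submodule.smul_mem _ _ (h1' _ _ (by omega))
    have := add_mem (add_mem a1 a2) a3
    convert this using 1
    ring
  · simp

lemma E_deg (c : Fin m → Fin m → Fin m → k) (i) {q} :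
    ∀ v ∈ Vf k m q, E c i v - X i * v ∈ Vf k m q := by
  intro v hv
  refine Vf_map (E c i - LinearMap.mulLeft k (X i)) _ ?_ v hv
  intro M hM
  simp only [LinearMap.sub_apply, E_mono, LinearMap.mulLeft_apply, X_mul_mono]
  exact Vf_mono (by omega) (act_deg c i M)

lemma X_deg (i : Fin m) {q} : ∀ v ∈ Vf k m q, X i * v ∈ Vf k m (q+1) := by
  refine Vf_map (LinearMap.mulLeft k (X i)) _ ?_
  intro M hM
  simp only [LinearMap.mulLeft_apply, X_mul_mono]
  exact mono_mem (by rw [deg_add]; omega)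

lemma E_deg' (c : Fin m → Fin m → Fin m → k) (i) {q} :
    ∀ v ∈ Vf k m q, E c i v ∈ Vf k m (q + 1) := by
  intro v hv
  have := add_mem (Vf_mono (by omega : q ≤ q + 1) (E_deg c i v hv)) (X_deg i v hv)
  simpa using this

lemma E_le (c : Fin m → Fin m → Fin m → k) (i) (M) (h : ∀ l ∈ M.support, i ≤ l) :
    E c i (monomial M 1) = monomial (single i 1 + M) 1 := by
  rw [E_mono, act, dif_neg]
  rintro ⟨h0, h1⟩
  have h1' : mn M h0 ∈ M.support := Finset.min'_mem _ _
  exact absurd (h _ h1') (not_le.2 h1)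

lemma E_gt (c : Fin m → Fin m → Fin m → k) (i j) (N) (h : ∀ l ∈ N.support, j ≤ l) (hij : j < i) :
    E c i (monomial (single j 1 + N) 1) = E c j (E c i (monomial N 1)) +
      ∑ l, c i j l • E c l (monomial N 1) := by
  have h0 := ne_zero_add j N
  have hmn := mn_add j N h h0
  rw [E_mono, act, dif_pos ⟨h0, by rwa [hmn]⟩]
  simp only [hmn, mn_sub, E_mono]
  congr 1
  refine Vf_eq _ _ ?_ (act c i N) (q := N.degree + 2) ?_
  · intro K hK
    rw [constr_mono, E_mono, dif_pos (by rw [deg_add]; omega)]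
  · rw [← E_mono]
    exact E_deg' _ _ _ (mono_mem (by omega))

lemma mono_cases (i : Fin m) (M : Fin m →₀ ℕ) : (∀ l ∈ M.support, i ≤ l) ∨
    ∃ j N, M = single j 1 + N ∧ (∀ l ∈ N.support, j ≤ l) ∧ j < i := by
  by_cases h : ∀ l ∈ M.support, i ≤ l
  · exact Or.inl h
  · right
    push Not at h
    obtain ⟨l, hl, hli⟩ := h
    have h0 : M ≠ 0 := by
      rintro rfl
      simp at hl
    refine ⟨mn M h0, M - single (mn M h0) 1, mn_spec M h0, ?_, lt_of_le_of_lt (mn_le M h0 l hl) hli⟩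
    intro l' hl'
    apply mn_le
    simp only [Finsupp.mem_support_iff, Finsupp.tsub_apply] at hl' ⊢
    omega


section lie
variable {g : Type*} [LieRing g] [LieAlgebra k g] (b : Module.Basis (Fin m) k g)

/-- structure constants -/
noncomputable def sc (i j l : Fin m) : k := b.repr ⁅b i, b j⁆ l

/-- the action of `g` -/
noncomputable def EL : g →ₗ[k] Module.End k (MvPolynomial (Fin m) k) :=
  b.constr k (fun i => E (sc b) i)

lemma EL_basis (i) : EL b (b i) = E (sc b) i := b.constr_basis _ _ _

lemma EL_bracket (i j) (v) : EL b ⁅b i, b j⁆ v = ∑ l, sc b i j l • E (sc b) l v := by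
  conv_lhs => rw [← b.sum_repr ⁅b i, b j⁆]
  simp only [map_sum, map_smul, LinearMap.sum_apply, LinearMap.smul_apply, EL_basis, sc]

lemma EL_le (i) (M) (h : ∀ l ∈ M.support, i ≤ l) :
    EL b (b i) (monomial M 1) = monomial (single i 1 + M) 1 := by
  rw [EL_basis]; exact E_le _ _ _ h

lemma EL_gt (i j) (N) (h : ∀ l ∈ N.support, j ≤ l) (hij : j < i) :
    EL b (b i) (monomial (single j 1 + N) 1) = EL b (b j) (EL b (b i) (monomial N 1)) +
      EL b ⁅b i, b j⁆ (monomial N 1) := by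
  rw [EL_bracket, EL_basis, EL_basis]; exact E_gt _ _ _ _ h hij

lemma EL_deg (x : g) {q} : ∀ v ∈ Vf k m q, EL b x v ∈ Vf k m (q + 1) := by
  intro v hv
  rw [← b.sum_repr x]
  simp only [map_sum, map_smul, LinearMap.sum_apply, LinearMap.smul_apply, EL_basis]
  exact Submodule.sum_mem _ fun l _ => Submodule.smul_mem _ _ (E_deg' _ _ _ hv)

/-- to check the Lie relation it is enough to do it on basis elements `j < i`. -/
lemma rel_of_basis (v : MvPolynomial (Fin m) k)
    (H : ∀ i j, j < i → EL b (b i) (EL b (b j) v) - EL b (b j) (EL b (b i) v) = EL b ⁅b i, b j⁆ v)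
    (x y : g) : EL b x (EL b y v) - EL b y (EL b x v) = EL b ⁅x, y⁆ v := by
  have H' : ∀ i j, EL b (b i) (EL b (b j) v) - EL b (b j) (EL b (b i) v) = EL b ⁅b i, b j⁆ v := by
    intro i j
    rcases lt_trichotomy i j with h | h | h
    · rw [← lie_skew, map_neg, LinearMap.neg_apply, ← H j i h]
      abel
    · subst h
      simp
    · exact H i j h
  let B1 : g →ₗ[k] g →ₗ[k] MvPolynomial (Fin m) k :=
    LinearMap.mk₂ k (fun x y => EL b x (EL b y v) - EL b y (EL b x v))
      (by intros; simp; abel) (by intros; simp [smul_sub]) (by intros; simp; abel)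
      (by intros; simp [smul_sub])
  let B2 : g →ₗ[k] g →ₗ[k] MvPolynomial (Fin m) k :=
    LinearMap.mk₂ k (fun x y => EL b ⁅x, y⁆ v)
      (by intros; simp) (by intros; simp) (by intros; simp)
      (by intros; simp)
  have : B1 = B2 := b.ext fun i => b.ext fun j => H' i j
  exact LinearMap.congr_fun₂ this x y

lemma rel (n : ℕ) : ∀ v ∈ Vf k m n, ∀ x y : g,
    EL b x (EL b y v) - EL b y (EL b x v) = EL b ⁅x, y⁆ v := by
  induction n with
  | zero =>
    intro v hv
    have : v = 0 := by simpa [Vf] using hv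
    simp [this]
  | succ n ih =>
    -- the base case : `j ≤ M`
    have base : ∀ i j : Fin m, j < i → ∀ M : Fin m →₀ ℕ, (∀ l ∈ M.support, j ≤ l) →
        EL b (b i) (EL b (b j) (monomial M 1)) - EL b (b j) (EL b (b i) (monomial M 1)) =
          EL b ⁅b i, b j⁆ (monomial M 1) := by
      intro i j hij M hM
      rw [EL_le b j M hM, EL_gt b i j M hM hij]
      abel
    intro v hv x y
    refine Vf_eq (q := n + 1) ((EL b x) ∘ₗ (EL b y) - (EL b y) ∘ₗ (EL b x)) (EL b ⁅x, y⁆) ?_ v hv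
    intro M hM
    refine rel_of_basis b (monomial M 1) ?_ x y
    clear x y
    intro i j hij
    rcases mono_cases j M with h | ⟨l, N, rfl, hN, hlj⟩
    · exact base i j hij M h
    · rw [deg_add] at hM
      have hmem : (monomial N (1 : k)) ∈ Vf k m n := mono_mem (by omega)
      have ihN := ih _ hmem
      -- key : swap `b i` and `b l` on `b j N`
      have swap : ∀ i j : Fin m, l < i → l < j →
          EL b (b i) (EL b (b l) (EL b (b j) (monomial N 1))) -
            EL b (b l) (EL b (b i) (EL b (b j) (monomial N 1))) =
          EL b ⁅b i, b l⁆ (EL b (b j) (monomial N 1)) := by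
        intro i j hi hj
        have hw : EL b (b j) (monomial N 1) - monomial (single j 1 + N) 1 ∈ Vf k m n := by
          rw [EL_basis, E_mono]
          exact Vf_mono (by omega) (act_deg _ _ _)
        have h1 := ih _ hw (b i) (b l)
        have h2 := base i l hi (single j 1 + N) (by
          intro t ht
          by_cases htj : j = t
          · rw [← htj]; exact hj.le
          · apply hN
            simp only [Finsupp.mem_support_iff, Finsupp.add_apply] at ht ⊢
            rwa [Finsupp.single_eq_of_ne (Ne.symm htj), zero_add] at ht)
        have := congrArg₂ (· + ·) h1 h2
        simp only [map_sub] at this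
        linear_combination (exp := 1) this
      have hli := hlj.trans hij
      rw [EL_gt b i l N hN hli, EL_gt b j l N hN hlj]
      simp only [map_add]
      have s1 := swap i j hli hlj
      have s2 := swap j i hlj hli
      have t1 := ihN (b i) ⁅b j, b l⁆
      have t2 := ihN (b j) ⁅b i, b l⁆
      have t3 := ih _ hmem (b i) (b j)
      have hbr := EL_gt b i l N hN hli
      -- `⁅b i, b j⁆` acting on `l N`
      have t4 : EL b ⁅b i, b j⁆ (monomial (single l 1 + N) 1) =
          EL b (b l) (EL b ⁅b i, b j⁆ (monomial N 1)) +
          EL b ⁅⁅b i, b j⁆, b l⁆ (monomial N 1) := by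
        rw [← ihN ⁅b i, b j⁆ (b l), EL_le b l N hN]
        abel
      rw [t4, ← t3]
      have jac : ⁅⁅b i, b j⁆, b l⁆ = ⁅b i, ⁅b j, b l⁆⁆ - ⁅b j, ⁅b i, b l⁆⁆ := lie_lie _ _ _
      rw [jac]
      simp only [map_sub, LinearMap.sub_apply]
      linear_combination (exp := 1) s1 - s2 + t1 - t2

attribute [local instance] LieRing.ofAssociativeRing

/-- The Lie algebra homomorphism. -/
noncomputable def ELie : g →ₗ⁅k⁆ Module.End k (MvPolynomial (Fin m) k) :=
  { EL b with
    map_lie' := by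
      intro x y
      apply LinearMap.ext
      intro w
      obtain ⟨q, hq⟩ := exists_Vf w
      exact (rel b q w hq x y).symm }

lemma U_lie (x y : g) : UniversalEnvelopingAlgebra.ι k ⁅x, y⁆ =
    UniversalEnvelopingAlgebra.ι k x * UniversalEnvelopingAlgebra.ι k y -
    UniversalEnvelopingAlgebra.ι k y * UniversalEnvelopingAlgebra.ι k x := by
  rw [LieHom.map_lie]; rfl

lemma U_ind (S : Subalgebra k (UniversalEnvelopingAlgebra k g))
    (h : ∀ x : g, UniversalEnvelopingAlgebra.ι k x ∈ S) (u) : u ∈ S := by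
  let f : g →ₗ⁅k⁆ S :=
    { toFun := fun x => ⟨UniversalEnvelopingAlgebra.ι k x, h x⟩
      map_add' := fun x y => Subtype.ext (by simp only [map_add]; rfl)
      map_smul' := fun x y => Subtype.ext (by simp only [map_smul]; rfl)
      map_lie' := fun {x y} => Subtype.ext (by
        simp only [U_lie]; rfl) }
  have : S.val.comp (UniversalEnvelopingAlgebra.lift k f) = AlgHom.id k _ := by
    apply UniversalEnvelopingAlgebra.hom_ext
    ext x
    change ((UniversalEnvelopingAlgebra.lift k f (UniversalEnvelopingAlgebra.ι k x) : S) :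
      UniversalEnvelopingAlgebra k g) = UniversalEnvelopingAlgebra.ι k x
    rw [UniversalEnvelopingAlgebra.lift_ι_apply]
    rfl
  have h2 := AlgHom.congr_fun this u
  change ((UniversalEnvelopingAlgebra.lift k f u : S) : UniversalEnvelopingAlgebra k g) = u at h2
  rw [← h2]
  exact Subtype.prop _

/-- `U(g)` acting on polynomials -/
noncomputable def rho : UniversalEnvelopingAlgebra k g →ₐ[k] Module.End k (MvPolynomial (Fin m) k) :=
  UniversalEnvelopingAlgebra.lift k (ELie b)

lemma rho_ι (x : g) : rho b (UniversalEnvelopingAlgebra.ι k x) = EL b x := by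
  unfold rho
  rw [UniversalEnvelopingAlgebra.lift_ι_apply]
  rfl

/-- ordered monomials in `U(g)` -/
noncomputable def om (M : Fin m →₀ ℕ) : UniversalEnvelopingAlgebra k g :=
  open Classical in
  if h : M ≠ 0 then
    UniversalEnvelopingAlgebra.ι k (b (mn M h)) * om (M - single (mn M h) 1)
  else 1
termination_by M.degree
decreasing_by
  have := deg_add (mn M h) (M - single (mn M h) 1)
  rw [← mn_spec] at this
  omega

lemma om_add (j) (N : Fin m →₀ ℕ) (h : ∀ l ∈ N.support, j ≤ l) :
    om b (single j 1 + N) = UniversalEnvelopingAlgebra.ι k (b j) * om b N := by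
  rw [om, dif_pos (ne_zero_add j N), mn_add j N h, mn_sub]

lemma om_zero : om b (0 : Fin m →₀ ℕ) = 1 := by
  rw [om, dif_neg (by simp)]

/-- linear extension of ordered monomials -/
noncomputable def phi : MvPolynomial (Fin m) k →ₗ[k] UniversalEnvelopingAlgebra k g :=
  (basisMonomials (Fin m) k).constr k (om b)

lemma phi_mono (M) : phi b (monomial M 1) = om b M := constr_mono _ _

lemma phi_EL_mono (i M) : phi b (EL b (b i) (monomial M 1)) =
    UniversalEnvelopingAlgebra.ι k (b i) * om b M := by
  induction i, M using meas_ind with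
  | _ i M h1 h2 =>
  rcases mono_cases i M with h | ⟨j, N, rfl, hN, hji⟩
  · rw [EL_le b i M h, phi_mono, om_add b i M h]
  · rw [EL_gt b i j N hN hji, map_add, om_add b j N hN]
    rw [deg_add] at h1 h2
    have e1 : phi b (EL b (b j) (EL b (b i) (monomial N 1))) =
        UniversalEnvelopingAlgebra.ι k (b j) * phi b (EL b (b i) (monomial N 1)) := by
      refine Vf_eq (q := N.degree + 2) (phi b ∘ₗ EL b (b j))
        (LinearMap.mulLeft k (UniversalEnvelopingAlgebra.ι k (b j)) ∘ₗ phi b) ?_ _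
        (EL_deg b _ _ (mono_mem (by omega)))
      intro K hK
      simp only [LinearMap.comp_apply, LinearMap.mulLeft_apply, phi_mono]
      exact h2 j K (by omega) hji
    have e2 : phi b (EL b ⁅b i, b j⁆ (monomial N 1)) =
        UniversalEnvelopingAlgebra.ι k ⁅b i, b j⁆ * om b N := by
      rw [← b.sum_repr ⁅b i, b j⁆]
      simp only [map_sum, map_smul, LinearMap.sum_apply, LinearMap.smul_apply, Finset.sum_mul,
        smul_mul_assoc]
      refine Finset.sum_congr rfl fun l _ => ?_
      rw [h1 l N (by omega)]
    rw [e1, e2, h1 i N (by omega), U_lie, sub_mul, mul_assoc, mul_assoc]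
    abel

lemma phi_EL (x : g) (v) : phi b (EL b x v) = UniversalEnvelopingAlgebra.ι k x * phi b v := by
  obtain ⟨q, hq⟩ := exists_Vf v
  refine Vf_eq (phi b ∘ₗ EL b x)
        (LinearMap.mulLeft k (UniversalEnvelopingAlgebra.ι k x) ∘ₗ phi b) ?_ v hq
  intro K hK
  simp only [LinearMap.comp_apply, LinearMap.mulLeft_apply, phi_mono]
  conv_lhs => rw [← b.sum_repr x]
  conv_rhs => rw [← b.sum_repr x]
  simp only [map_sum, map_smul, LinearMap.sum_apply, LinearMap.smul_apply, Finset.sum_mul,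
    smul_mul_assoc, phi_EL_mono]

/-- evaluation at `1` -/
noncomputable def psi : UniversalEnvelopingAlgebra k g →ₗ[k] MvPolynomial (Fin m) k :=
  (LinearMap.applyₗ (monomial (0 : Fin m →₀ ℕ) (1 : k))) ∘ₗ (rho b).toLinearMap

lemma psi_apply (u) : psi b u = rho b u (monomial 0 1) := rfl

lemma phi_psi (u) : phi b (psi b u) = u := by
  let S : Subalgebra k (UniversalEnvelopingAlgebra k g) :=
    { carrier := {u | ∀ v, phi b (rho b u v) = u * phi b v}
      mul_mem' := by
        intro x y hx hy v
        rw [map_mul, Module.End.mul_apply, hx, hy, mul_assoc]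
      add_mem' := by
        intro x y hx hy v
        rw [map_add, LinearMap.add_apply, map_add, hx, hy, add_mul]
      algebraMap_mem' := by
        intro r v
        simp [Algebra.algebraMap_eq_smul_one] }
  have : u ∈ S := U_ind S (fun x v => by rw [rho_ι, phi_EL]) u
  rw [psi_apply, this, phi_mono, om_zero, mul_one]

lemma psi_ι_mul (x : g) (u) : psi b (UniversalEnvelopingAlgebra.ι k x * u) = EL b x (psi b u) := by
  rw [psi_apply, map_mul, rho_ι]; rfl

lemma psi_om (M) : psi b (om b M) = monomial M 1 := by
  induction hn : M.degree using Nat.strong_induction_on generalizing M with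
  | _ n ih =>
    by_cases h : M = 0
    · subst h
      rw [om_zero, psi_apply, map_one]; rfl
    · have h1 := mn_spec M h
      have h2 := mn_le M h
      generalize mn M h = j at h1 h2
      generalize M - single j 1 = N at h1
      subst h1
      have h3 : ∀ l ∈ N.support, j ≤ l := by
        intro l hl
        apply h2
        simp only [Finsupp.mem_support_iff, Finsupp.add_apply] at hl ⊢
        omega
      rw [deg_add] at hn
      rw [om_add b j N h3, psi_ι_mul, ih N.degree (by omega) N rfl, EL_le b j N h3]

lemma psi_phi (v) : psi b (phi b v) = v := by
  obtain ⟨q, hq⟩ := exists_Vf v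
  refine Vf_eq (psi b ∘ₗ phi b) LinearMap.id ?_ v hq
  intro M hM
  simp [phi_mono, psi_om]

/-- derivatives on `U(g)` -/
noncomputable def D (i : Fin m) : UniversalEnvelopingAlgebra k g →ₗ[k] UniversalEnvelopingAlgebra k g :=
  phi b ∘ₗ (pderiv i).toLinearMap ∘ₗ psi b

/-- filtration on `U(g)` -/
noncomputable def Uf (q : ℕ) : Submodule k (UniversalEnvelopingAlgebra k g) :=
  (Vf k m q).comap (psi b)

lemma D_phi (i) (v) : D b i (phi b v) = phi b (pderiv i v) := by
  simp [D, psi_phi]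

lemma phi_mem {q} {v} : phi b v ∈ Uf b q ↔ v ∈ Vf k m q := by
  simp [Uf, psi_phi]

lemma pderiv_mem (i : Fin m) {q} : ∀ v ∈ Vf k m (q+1), pderiv i v ∈ Vf k m q := by
  refine Vf_map (pderiv i).toLinearMap _ ?_
  intro M hM
  change pderiv i (monomial M 1) ∈ _
  rw [pderiv_monomial]
  by_cases h : M i = 0
  · simp [h]
  · have h1 : single i 1 + (M - single i 1) = M := by
      rw [add_tsub_cancel_of_le]
      rw [Finsupp.single_le_iff]
      omega
    have h2 := deg_add i (M - single i 1)
    rw [h1] at h2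
    have : monomial (M - single i 1) (1 * (M i : k)) = (M i : k) • monomial (M - single i 1) 1 := by
      simp [smul_monomial]
    rw [this]
    exact Submodule.smul_mem _ _ (mono_mem (by omega))

lemma Uf_zero : Uf b 0 = ⊥ := by
  rw [eq_bot_iff]
  intro u hu
  have : psi b u = 0 := by simpa [Uf, Vf] using hu
  rw [Submodule.mem_bot, ← phi_psi b u, this, map_zero]

lemma Uf_one {u} (hu : u ∈ Uf b 1) : ∃ r : k, u = r • 1 := by
  have : Vf k m 1 ≤ Submodule.span k {monomial 0 1} := by
    apply Submodule.span_le.2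
    rintro v ⟨M, hM, rfl⟩
    have : M = 0 := by
      rw [← Finsupp.degree_eq_zero_iff]; omega
    subst this
    exact Submodule.mem_span_singleton_self _
  obtain ⟨r, hr⟩ := Submodule.mem_span_singleton.1 (this hu)
  refine ⟨r, ?_⟩
  rw [← phi_psi b u, ← hr, map_smul, phi_mono, om_zero]

lemma Uf_mono {p q : ℕ} (h : p ≤ q) : Uf b p ≤ Uf b q := fun _ hu => Vf_mono h hu

lemma exists_Uf (u) : ∃ q, u ∈ Uf b q := exists_Vf (psi b u)

lemma ι_mul_mem (x : g) {q} {u} (hu : u ∈ Uf b q) :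
    UniversalEnvelopingAlgebra.ι k x * u ∈ Uf b (q + 1) := by
  change psi b _ ∈ Vf k m (q + 1)
  rw [psi_ι_mul]
  exact EL_deg b x _ hu

lemma D_mem (i) {q} {u} (hu : u ∈ Uf b (q + 1)) : D b i u ∈ Uf b q := by
  obtain ⟨v, rfl⟩ : ∃ v, u = phi b v := ⟨_, (phi_psi b u).symm⟩
  rw [D_phi, phi_mem]
  exact pderiv_mem i v ((phi_mem b).1 hu)

lemma D_comm_basis (i j) {q} {u} (hu : u ∈ Uf b (q + 1)) :
    D b i (UniversalEnvelopingAlgebra.ι k (b j) * u) - UniversalEnvelopingAlgebra.ι k (b j) * D b i u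
      - (b.repr (b j) i) • u ∈ Uf b q := by
  obtain ⟨v, rfl⟩ : ∃ v, u = phi b v := ⟨_, (phi_psi b u).symm⟩
  have hv := (phi_mem b).1 hu
  rw [D_phi, ← phi_EL, D_phi, ← phi_EL, ← map_sub, ← map_smul, ← map_sub, phi_mem]
  have h1 : EL b (b j) v - X j * v ∈ Vf k m (q+1) := by rw [EL_basis]; exact E_deg _ _ v hv
  have h2 := pderiv_mem i _ h1
  have h3 : EL b (b j) (pderiv i v) - X j * (pderiv i v) ∈ Vf k m q := by
    rw [EL_basis]; exact E_deg _ _ _ (pderiv_mem i v hv)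
  have := sub_mem h2 h3
  convert this using 1
  rw [map_sub, Derivation.leibniz, pderiv_X, b.repr_self_apply]
  by_cases h : i = j
  · subst h
    simp
    ring
  · simp [h, Ne.symm h, Pi.single_apply]

lemma D_comm (i) (x : g) {q} {u} (hu : u ∈ Uf b (q + 1)) :
    D b i (UniversalEnvelopingAlgebra.ι k x * u) - UniversalEnvelopingAlgebra.ι k x * D b i u
      - (b.repr x i) • u ∈ Uf b q := by
  let f : g →ₗ[k] UniversalEnvelopingAlgebra k g :=
    (D b i) ∘ₗ (LinearMap.mulRight k u) ∘ₗ (UniversalEnvelopingAlgebra.ι k : g →ₗ⁅k⁆ _).toLinearMap -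
    (LinearMap.mulRight k (D b i u)) ∘ₗ (UniversalEnvelopingAlgebra.ι k : g →ₗ⁅k⁆ _).toLinearMap -
    (b.coord i).smulRight u
  have hf : ∀ x, f x = D b i (UniversalEnvelopingAlgebra.ι k x * u) -
     UniversalEnvelopingAlgebra.ι k x * D b i u - (b.repr x i) • u := fun x => rfl
  rw [← hf, ← b.sum_repr x, map_sum]
  refine Submodule.sum_mem _ fun j _ => ?_
  rw [map_smul, hf]
  exact Submodule.smul_mem _ _ (D_comm_basis b i j hu)

lemma euler_mem {q} : ∀ v ∈ Vf k m (q+1), ∑ i, X i * pderiv i v - (q : k) • v ∈ Vf k m q := by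
  let f : MvPolynomial (Fin m) k →ₗ[k] MvPolynomial (Fin m) k :=
    ∑ i, LinearMap.mulLeft k (X i) ∘ₗ (pderiv i).toLinearMap - (q : k) • LinearMap.id
  have hf : ∀ v, f v = ∑ i, X i * pderiv i v - (q : k) • v := by
    intro v
    simp only [f, LinearMap.sub_apply, LinearMap.sum_apply]
    rfl
  intro v hv
  rw [← hf]
  refine Vf_map f _ ?_ v hv
  intro M hM
  have e : f (monomial M 1) = ((M.degree : k) - (q : k)) • monomial M 1 := by
    have e1 : ∀ i, X i * pderiv i (monomial M (1 : k)) = (M i : k) • monomial M 1 := by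
      intro i
      rw [pderiv_monomial]
      by_cases h : M i = 0
      · simp [h]
      · have h1 : single i 1 + (M - single i 1) = M := by
          rw [add_tsub_cancel_of_le]
          rw [Finsupp.single_le_iff]
          omega
        rw [X, monomial_mul, h1]
        simp [smul_monomial]
    rw [hf]
    simp only [e1]
    rw [← Finset.sum_smul, sub_smul, Finsupp.degree_eq_sum, Nat.cast_sum]
  rw [e]
  rcases Nat.lt_succ_iff_lt_or_eq.1 hM with h | h
  · exact Submodule.smul_mem _ _ (mono_mem h)
  · rw [h]; simp

lemma D_euler {q} {u} (hu : u ∈ Uf b (q + 1)) :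
    ∑ i, UniversalEnvelopingAlgebra.ι k (b i) * D b i u - (q : k) • u ∈ Uf b q := by
  obtain ⟨v, rfl⟩ : ∃ v, u = phi b v := ⟨_, (phi_psi b u).symm⟩
  have hv := (phi_mem b).1 hu
  simp only [D_phi, ← phi_EL]
  rw [← map_sum, ← map_smul, ← map_sub, phi_mem]
  have h1 := euler_mem v hv
  have h2 : ∑ i, (EL b (b i) (pderiv i v) - X i * pderiv i v) ∈ Vf k m q :=
    Submodule.sum_mem _ fun i _ => by
      rw [EL_basis]; exact E_deg _ _ _ (pderiv_mem i v hv)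
  have := add_mem h1 h2
  rw [Finset.sum_sub_distrib] at this
  convert this using 1
  ring

end lie
end PBW
namespace CEext

/-- left wedge multiplication -/
noncomputable def wedgeL (n : ℕ) : g →ₗ[k] (⋀[k]^n g) →ₗ[k] (⋀[k]^(n + 1) g) :=
  LinearMap.mk₂ k (fun x w => ⟨ExteriorAlgebra.ι k x * w.1, by
      change _ ∈ (LinearMap.range (ExteriorAlgebra.ι k : g →ₗ[k] _)) ^ (n + 1)
      rw [pow_succ']
      exact Submodule.mul_mem_mul (LinearMap.mem_range_self _ x) w.2⟩)
    (fun x y w => Subtype.ext (by simp [add_mul]))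
    (fun c x w => Subtype.ext (by simp))
    (fun x w w' => Subtype.ext (by simp [mul_add]))
    (fun c x w => Subtype.ext (by simp))

variable {k}

lemma wedgeL_coe (n) (x : g) (w : ⋀[k]^n g) :
    (wedgeL k n x w : ExteriorAlgebra k g) = ExteriorAlgebra.ι k x * w := rfl

lemma wedgeL_wedgePow (n) (x : g) (y : Fin n → g) :
    wedgeL k n x (wedgePow k n y) = wedgePow k (n + 1) (Fin.cons x y) := by
  apply Subtype.ext
  rw [wedgeL_coe]
  change _ = ExteriorAlgebra.ιMulti k (n + 1) (Fin.cons x y)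
  rw [ExteriorAlgebra.ιMulti_succ_apply]
  rfl

lemma wedgePow_succ (n) (y : Fin (n + 1) → g) :
    wedgePow k (n + 1) y = wedgeL k n (y 0) (wedgePow k n (fun i => y i.succ)) := by
  rw [wedgeL_wedgePow]
  congr 1
  exact (Fin.cons_self_tail y).symm

lemma wedgeL_anti (n) (x y : g) (w : ⋀[k]^n g) :
    wedgeL k (n + 1) x (wedgeL k n y w) = - wedgeL k (n + 1) y (wedgeL k n x w) := by
  apply Subtype.ext
  simp only [Submodule.coe_neg, wedgeL_coe, ← mul_assoc]
  rw [← neg_mul]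
  congr 1
  have := ExteriorAlgebra.ι_add_mul_swap (R := k) x y
  exact eq_neg_of_add_eq_zero_left this

lemma span_wedgePow (n) : Submodule.span k (Set.range (wedgePow k n (g := g))) = ⊤ := by
  exact exteriorPower.ιMulti_span k n g

lemma span_zero (w : ⋀[k]^0 g) (y : Fin 0 → g) : ∃ r : k, w = r • wedgePow k 0 y := by
  have h : w ∈ Submodule.span k (Set.range (wedgePow k 0 (g := g))) := by
    rw [span_wedgePow]; trivial
  have h2 : Set.range (wedgePow k 0 (g := g)) = {wedgePow k 0 y} := by
    ext t
    constructor
    · rintro ⟨y', rfl⟩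
      rw [Subsingleton.elim y' y]; rfl
    · rintro rfl
      exact ⟨y, rfl⟩
  rw [h2] at h
  obtain ⟨r, hr⟩ := Submodule.mem_span_singleton.1 h
  exact ⟨r, hr.symm⟩

lemma ext_wedge {W : Type*} [AddCommGroup W] [Module k W] (n) (f f' : (⋀[k]^n g) →ₗ[k] W)
    (h : ∀ y, f (wedgePow k n y) = f' (wedgePow k n y)) : f = f' := by
  apply LinearMap.ext_on_range (span_wedgePow n)
  exact h

lemma ext_wedgeL {W : Type*} [AddCommGroup W] [Module k W] (n) (f f' : (⋀[k]^(n + 1) g) →ₗ[k] W)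
    (h : ∀ x w, f (wedgeL k n x w) = f' (wedgeL k n x w)) : f = f' := by
  apply ext_wedge
  intro y
  rw [wedgePow_succ, h]

/-- derivation hom -/
noncomputable def derHom (f : g →ₗ[k] g) :
    ExteriorAlgebra k g →ₐ[k] TrivSqZeroExt (ExteriorAlgebra k g) (ExteriorAlgebra k g) :=
  ExteriorAlgebra.lift k ⟨
    { toFun := fun y => TrivSqZeroExt.inl (ExteriorAlgebra.ι k y) + TrivSqZeroExt.inr (ExteriorAlgebra.ι k (f y))
      map_add' := by
        intro x y
        ext <;> simp
      map_smul' := by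
        intro c x
        ext <;> simp }, by
    intro y
    ext
    · simp
    · have := ExteriorAlgebra.ι_add_mul_swap (R := k) y (f y)
      simpa using this⟩

/-- the derivation of the exterior algebra extending `f`. -/
noncomputable def der (f : g →ₗ[k] g) : ExteriorAlgebra k g →ₗ[k] ExteriorAlgebra k g :=
  (TrivSqZeroExt.sndHom (ExteriorAlgebra k g) (ExteriorAlgebra k g)).restrictScalars k ∘ₗ
    (derHom f).toLinearMap

lemma derHom_fst (f : g →ₗ[k] g) (w) : (derHom f w).fst = w := by
  have : (TrivSqZeroExt.fstHom k (ExteriorAlgebra k g) (ExteriorAlgebra k g)).comp (derHom f) =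
      AlgHom.id k _ := by
    apply ExteriorAlgebra.hom_ext
    ext y
    simp [derHom]
  exact AlgHom.congr_fun this w

lemma der_apply (f : g →ₗ[k] g) (w) : der f w = (derHom f w).snd := rfl

lemma der_ι_mul (f : g →ₗ[k] g) (y : g) (w) :
    der f (ExteriorAlgebra.ι k y * w) = ExteriorAlgebra.ι k y * der f w +
      ExteriorAlgebra.ι k (f y) * w := by
  have : derHom f (ExteriorAlgebra.ι k y) =
    TrivSqZeroExt.inl (ExteriorAlgebra.ι k y) + TrivSqZeroExt.inr (ExteriorAlgebra.ι k (f y)) := by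
    simp [derHom]
  rw [der_apply, der_apply, map_mul, TrivSqZeroExt.snd_mul, this, derHom_fst]
  simp

lemma der_one (f : g →ₗ[k] g) : der f 1 = 0 := by
  rw [der_apply, map_one]; rfl

lemma der_mem (f : g →ₗ[k] g) (n) : ∀ w ∈ ⋀[k]^n g, der f w ∈ ⋀[k]^n g := by
  induction n with
  | zero =>
    intro w hw
    obtain ⟨r, hr⟩ := span_zero (⟨w, hw⟩ : ⋀[k]^0 g) (fun i => i.elim0)
    have : w = r • 1 := by
      have := congrArg Subtype.val hr
      simpa [wedgePow] using this
    rw [this, map_smul, der_one, smul_zero]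
    exact Submodule.zero_mem _
  | succ n ih =>
    intro w hw
    have : (⟨w, hw⟩ : ⋀[k]^(n+1) g) ∈
        ((⋀[k]^(n+1) g).comap (der f)).comap (⋀[k]^(n+1) g).subtype := by
      have h : (⟨w, hw⟩ : ⋀[k]^(n+1) g) ∈
        Submodule.span k (Set.range (wedgePow k (n + 1) (g := g))) := by
        rw [span_wedgePow]; trivial
      refine Submodule.span_le.2 ?_ h
      rintro _ ⟨y, rfl⟩
      change der f _ ∈ ⋀[k]^(n+1) g
      rw [wedgePow_succ, Submodule.subtype_apply, wedgeL_coe, der_ι_mul]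
      exact add_mem (wedgeL k n (y 0) ⟨_, ih _ (Subtype.prop _)⟩).2
        (wedgeL k n (f (y 0)) _).2
    exact this

end CEext

namespace CEext
variable {k : Type*} {g : Type*} [Field k] [LieRing g] [LieAlgebra k g]

/-- adjoint action on exterior powers -/
noncomputable def ad (n : ℕ) (x : g) : (⋀[k]^n g) →ₗ[k] (⋀[k]^n g) :=
  (der (LieAlgebra.ad k g x : g →ₗ[k] g)).restrict (der_mem _ n)

lemma ad_coe (n) (x : g) (w : ⋀[k]^n g) :
    (ad n x w : ExteriorAlgebra k g) = der (LieAlgebra.ad k g x : g →ₗ[k] g) w := rfl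

lemma ad_wedgeL (n) (x y : g) (w : ⋀[k]^n g) :
    ad (n + 1) x (wedgeL k n y w) = wedgeL k n y (ad n x w) + wedgeL k n ⁅x, y⁆ w := by
  apply Subtype.ext
  rw [ad_coe, wedgeL_coe, der_ι_mul]
  rfl

lemma ad_zero (x : g) (w : ⋀[k]^0 g) : ad 0 x w = 0 := by
  obtain ⟨r, hr⟩ := span_zero w (fun i => i.elim0)
  apply Subtype.ext
  rw [hr, map_smul, Submodule.coe_smul, ad_coe]
  simp [wedgePow, der_one]

lemma ad_ad (n) (x y : g) (w : ⋀[k]^n g) :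
    ad n x (ad n y w) - ad n y (ad n x w) = ad n ⁅x, y⁆ w := by
  induction n with
  | zero => simp [ad_zero]
  | succ n ih =>
    have : ad (n + 1) x ∘ₗ ad (n + 1) y - ad (n + 1) y ∘ₗ ad (n + 1) x =
        ad (k := k) (n + 1) ⁅x, y⁆ := by
      apply ext_wedgeL
      intro z w
      simp only [LinearMap.sub_apply, LinearMap.comp_apply, ad_wedgeL, map_add, ← ih]
      rw [lie_lie]
      simp only [map_sub, LinearMap.sub_apply]
      abel
    exact LinearMap.congr_fun this w

lemma cons_succAbove {n} (x : g) (y : Fin (n + 1) → g) (i : Fin (n + 1)) :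
    (Fin.cons x y : Fin (n + 2) → g) ∘ i.succ.succAbove = Fin.cons x (y ∘ i.succAbove) := by
  ext t
  refine Fin.cases ?_ (fun t => ?_) t <;> simp

lemma cons_succAbove_zero {n} (x : g) (y : Fin n → g) :
    (Fin.cons x y : Fin (n + 1) → g) ∘ (0 : Fin (n + 1)).succAbove = y := by
  ext t
  simp

lemma ad_wedgePow (n) (x : g) (y : Fin (n + 1) → g) : ad (n + 1) x (wedgePow k (n + 1) y) =
    ∑ j : Fin (n + 1), ((-1 : k) ^ (j : ℕ)) • wedgeL k n ⁅x, y j⁆ (wedgePow k n (y ∘ j.succAbove)) := by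
  induction n with
  | zero =>
    rw [wedgePow_succ, ad_wedgeL, ad_zero]
    rw [Fin.sum_univ_succ, map_zero]
    refine (zero_add _).trans ?_
    rw [Finset.univ_eq_empty, Finset.sum_empty]
    refine Eq.trans ?_ (add_zero _).symm
    rw [Fin.val_zero, pow_zero, one_smul]
    rfl
  | succ n ih =>
    obtain ⟨x0, y', rfl⟩ : ∃ x0 y', y = Fin.cons x0 y' := ⟨_, _, (Fin.cons_self_tail y).symm⟩
    rw [← wedgeL_wedgePow, ad_wedgeL, Fin.sum_univ_succ, ih, cons_succAbove_zero]
    simp only [cons_succAbove, ← wedgeL_wedgePow, Fin.cons_zero, Fin.cons_succ, Fin.val_zero,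
      pow_zero, one_smul, Fin.val_succ, pow_succ, map_sum, map_smul]
    refine (add_comm _ _).trans ?_
    congr 1
    refine Finset.sum_congr rfl fun j _ => ?_
    rw [wedgeL_anti, mul_neg_one, smul_neg]
    exact (neg_smul _ _).symm

lemma bvec_bound {n : ℕ} (i j : Fin (n + 1)) (h : i < j) (m : Fin n) :
    (if (m : ℕ) - 1 < (i : ℕ) then (m : ℕ) - 1
      else if (m : ℕ) < (j : ℕ) then (m : ℕ) else (m : ℕ) + 1) < n + 1 := by
  grind

/-- the bracket vector in the differential -/
def bvec {n : ℕ} (x : Fin (n + 1) → g) (i j : Fin (n + 1)) (h : i < j) : Fin n → g :=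
  fun m : Fin n =>
    if hm : (m : ℕ) = 0 then ⁅x i, x j⁆
    else x ⟨if (m : ℕ) - 1 < (i : ℕ) then (m : ℕ) - 1
            else if (m : ℕ) < (j : ℕ) then (m : ℕ)
            else (m : ℕ) + 1,
          bvec_bound i j h m⟩

lemma bvec_zero {n} (x : g) (y : Fin (n + 1) → g) (j : Fin (n + 1)) (h : (0 : Fin (n + 2)) < j.succ) :
    bvec (Fin.cons x y : Fin (n + 2) → g) 0 j.succ h = Fin.cons ⁅x, y j⁆ (y ∘ j.succAbove) := by
  funext t
  refine Fin.cases ?_ (fun t => ?_) t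
  · simp [bvec]
  · simp only [bvec, Fin.val_succ, Nat.add_eq_zero_iff, one_ne_zero, and_false, dite_false,
      Fin.cons_succ, Function.comp_apply, Fin.val_zero, not_lt_zero, if_false, add_lt_add_iff_right]
    have : (⟨if (t : ℕ) < j then (t : ℕ) + 1 else (t : ℕ) + 1 + 1, by split <;> omega⟩ : Fin (n + 2)) =
      (j.succAbove t).succ := by
      apply Fin.ext
      simp only [Fin.val_succ, Fin.succAbove, Fin.lt_def, Fin.val_castSucc]
      split_ifs <;> simp
    rw [this, Fin.cons_succ]

lemma bvec_succ {n} (x : g) (y : Fin (n + 1) → g) (i j : Fin (n + 1)) (h : i.succ < j.succ)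
    (h' : i < j) :
    wedgePow k (n + 1) (bvec (Fin.cons x y : Fin (n + 2) → g) i.succ j.succ h) =
      - wedgeL k n x (wedgePow k n (bvec y i j h')) := by
  cases n with
  | zero => omega
  | succ n =>
    rw [wedgePow_succ, wedgePow_succ, wedgePow_succ n, wedgeL_anti]
    have e1 : bvec (Fin.cons x y : Fin (n + 3) → g) i.succ j.succ h 0 = bvec y i j h' 0 := by
      simp [bvec]
    have e2 : bvec (Fin.cons x y : Fin (n + 3) → g) i.succ j.succ h (Fin.succ 0) = x := by
      simp [bvec]
    have e3 : ∀ t : Fin n, bvec (Fin.cons x y : Fin (n + 3) → g) i.succ j.succ h t.succ.succ =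
        bvec y i j h' t.succ := by
      intro t
      simp only [bvec, Fin.val_succ, Nat.add_eq_zero_iff, one_ne_zero, and_false, dite_false,
        add_tsub_cancel_right, add_lt_add_iff_right]
      have := j.isLt
      have h'' : (i : ℕ) < j := h'
      have : ∀ (a b : ℕ) (ha : a < n + 3) (hb : b < n + 2), a = b + 1 →
        (Fin.cons x y : Fin (n + 3) → g) ⟨a, ha⟩ = y ⟨b, hb⟩ := by
        rintro a b ha hb rfl
        rfl
      apply this
      split_ifs <;> rfl
    simp only [e1, e2, e3]

end CEext

namespace CEc
variable {k : Type*} {g : Type*} [Field k] [LieRing g] [LieAlgebra k g]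
open CEext

/-- the terms of the complex -/
abbrev P (k g : Type*) [Field k] [LieRing g] [LieAlgebra k g] (n : ℕ) : Type _ :=
  UniversalEnvelopingAlgebra k g ⊗[k] ((⋀[k]^n g) ⊗[k] UniversalEnvelopingAlgebra k g)

/-- wedge multiplication in the middle factor -/
noncomputable def E (n : ℕ) : g →ₗ[k] P k g n →ₗ[k] P k g (n + 1) :=
  (LinearMap.lTensorHom (UniversalEnvelopingAlgebra k g)) ∘ₗ
    (LinearMap.rTensorHom (UniversalEnvelopingAlgebra k g)) ∘ₗ wedgeL k n

lemma E_tmul (n) (x : g) (a u : UniversalEnvelopingAlgebra k g) (w : ⋀[k]^n g) :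
    E n x (a ⊗ₜ[k] (w ⊗ₜ[k] u)) = a ⊗ₜ[k] (wedgeL k n x w ⊗ₜ[k] u) := rfl

/-- inner part of the Lie derivative: acts on the two left factors -/
noncomputable def L1 (n : ℕ) (x : g) : P k g n →ₗ[k] P k g n :=
  LinearMap.lTensor (UniversalEnvelopingAlgebra k g)
      (LinearMap.rTensor (UniversalEnvelopingAlgebra k g) (ad n x)) -
    LinearMap.rTensor _ (LinearMap.mulRight k (UniversalEnvelopingAlgebra.ι k x))

/-- left multiplication on the last factor -/
noncomputable def L2 (n : ℕ) (x : g) : P k g n →ₗ[k] P k g n :=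
  LinearMap.lTensor (UniversalEnvelopingAlgebra k g)
    (LinearMap.lTensor _ (LinearMap.mulLeft k (UniversalEnvelopingAlgebra.ι k x)))

/-- Lie derivative -/
noncomputable def L (n : ℕ) (x : g) : P k g n →ₗ[k] P k g n := L1 n x + L2 n x

lemma L1_tmul (n) (x : g) (a u : UniversalEnvelopingAlgebra k g) (w : ⋀[k]^n g) :
    L1 n x (a ⊗ₜ[k] (w ⊗ₜ[k] u)) = a ⊗ₜ[k] (ad n x w ⊗ₜ[k] u) -
      (a * UniversalEnvelopingAlgebra.ι k x) ⊗ₜ[k] (w ⊗ₜ[k] u) := rfl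

lemma L2_tmul (n) (x : g) (a u : UniversalEnvelopingAlgebra k g) (w : ⋀[k]^n g) :
    L2 n x (a ⊗ₜ[k] (w ⊗ₜ[k] u)) =
      a ⊗ₜ[k] (w ⊗ₜ[k] (UniversalEnvelopingAlgebra.ι k x * u)) := rfl

lemma L_apply (n) (x : g) (z : P k g n) : L n x z = L1 n x z + L2 n x z := rfl

lemma L_tmul (n) (x : g) (a u : UniversalEnvelopingAlgebra k g) (w : ⋀[k]^n g) :
    L n x (a ⊗ₜ[k] (w ⊗ₜ[k] u)) = a ⊗ₜ[k] (ad n x w ⊗ₜ[k] u) -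
      (a * UniversalEnvelopingAlgebra.ι k x) ⊗ₜ[k] (w ⊗ₜ[k] u) +
      a ⊗ₜ[k] (w ⊗ₜ[k] (UniversalEnvelopingAlgebra.ι k x * u)) := rfl

lemma sub_mid {n} (a u : UniversalEnvelopingAlgebra k g) (w w' : ⋀[k]^n g) :
    a ⊗ₜ[k] ((w - w') ⊗ₜ[k] u) = a ⊗ₜ[k] (w ⊗ₜ[k] u) - a ⊗ₜ[k] (w' ⊗ₜ[k] u) := by
  rw [TensorProduct.sub_tmul]
  exact TensorProduct.tmul_sub _ _ _

lemma sub_left {n} (a a' u : UniversalEnvelopingAlgebra k g) (w : ⋀[k]^n g) :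
    (a - a') ⊗ₜ[k] (w ⊗ₜ[k] u) = a ⊗ₜ[k] (w ⊗ₜ[k] u) - a' ⊗ₜ[k] (w ⊗ₜ[k] u) :=
  TensorProduct.sub_tmul _ _ _

lemma neg_mid {n} (a u : UniversalEnvelopingAlgebra k g) (w : ⋀[k]^n g) :
    a ⊗ₜ[k] ((- w) ⊗ₜ[k] u) = - (a ⊗ₜ[k] (w ⊗ₜ[k] u)) := by
  rw [TensorProduct.neg_tmul w u]
  exact TensorProduct.tmul_neg (R := k) a (w ⊗ₜ[k] u)

lemma sub_last {n} (a u u' : UniversalEnvelopingAlgebra k g) (w : ⋀[k]^n g) :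
    a ⊗ₜ[k] (w ⊗ₜ[k] (u - u')) = a ⊗ₜ[k] (w ⊗ₜ[k] u) - a ⊗ₜ[k] (w ⊗ₜ[k] u') := by
  rw [TensorProduct.tmul_sub w u u']
  exact TensorProduct.tmul_sub _ _ _

lemma neg_smul_P {n} (c : k) (z : P k g n) : (- c) • z = - (c • z) := neg_smul c z

lemma smul_neg_P {n} (c : k) (z : P k g n) : c • (- z) = - (c • z) := smul_neg c z

lemma ext_P {W : Type*} [AddCommGroup W] [Module k W] {n} (f f' : P k g n →ₗ[k] W)
    (h : ∀ a w u, f (a ⊗ₜ[k] (w ⊗ₜ[k] u)) = f' (a ⊗ₜ[k] (w ⊗ₜ[k] u))) : f = f' := by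
  refine TensorProduct.ext (LinearMap.ext fun a => TensorProduct.ext ?_)
  exact LinearMap.ext fun w => LinearMap.ext fun u => h a w u

lemma ext_Pw {W : Type*} [AddCommGroup W] [Module k W] {n} (f f' : P k g n →ₗ[k] W)
    (h : ∀ a y u, f (a ⊗ₜ[k] (wedgePow k n y ⊗ₜ[k] u)) =
      f' (a ⊗ₜ[k] (wedgePow k n y ⊗ₜ[k] u))) : f = f' := by
  refine TensorProduct.ext (LinearMap.ext fun a => TensorProduct.ext ?_)
  exact ext_wedge n _ _ fun y => LinearMap.ext fun u => h a y u

lemma L_E (n) (x y : g) (z : P k g n) :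
    L (n + 1) x (E n y z) = E n y (L n x z) + E n ⁅x, y⁆ z := by
  have : L (n + 1) x ∘ₗ E n y = E (k := k) n y ∘ₗ L n x + E n ⁅x, y⁆ := by
    apply ext_P
    intro a w u
    simp only [LinearMap.comp_apply, LinearMap.add_apply, L_tmul, E_tmul, ad_wedgeL, map_add,
      map_sub, TensorProduct.add_tmul, TensorProduct.tmul_add]
    abel
  exact LinearMap.congr_fun this z

lemma L_L (n) (x y : g) (z : P k g n) :
    L n x (L n y z) - L n y (L n x z) = L n ⁅x, y⁆ z := by
  have : L n x ∘ₗ L n y - L n y ∘ₗ L n x = L (k := k) n ⁅x, y⁆ := by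
    apply ext_P
    intro a w u
    simp only [LinearMap.comp_apply, LinearMap.sub_apply, L_tmul, ← ad_ad, PBW.U_lie, map_add,
      map_sub, sub_mid, sub_last, sub_left, mul_sub, sub_mul, mul_assoc]
    abel
  exact LinearMap.congr_fun this z

lemma E_E (n) (x y : g) (z : P k g n) :
    E (n + 1) x (E n y z) = - E (n + 1) y (E n x z) := by
  have : E (n + 1) x ∘ₗ E n y = - (E (k := k) (n + 1) y ∘ₗ E n x) := by
    apply ext_P
    intro a w u
    simp only [LinearMap.comp_apply, LinearMap.neg_apply, E_tmul]
    rw [wedgeL_anti, neg_mid]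
  exact LinearMap.congr_fun this z

section filt
variable {m : ℕ} (b : Module.Basis (Fin m) k g)

/-- derivative on last factor -/
noncomputable def Dl (n : ℕ) (i : Fin m) : P k g n →ₗ[k] P k g n :=
  LinearMap.lTensor (UniversalEnvelopingAlgebra k g) (LinearMap.lTensor _ (PBW.D b i))

lemma Dl_tmul (n i) (a u : UniversalEnvelopingAlgebra k g) (w : ⋀[k]^n g) :
    Dl b n i (a ⊗ₜ[k] (w ⊗ₜ[k] u)) = a ⊗ₜ[k] (w ⊗ₜ[k] PBW.D b i u) := rfl

/-- filtration -/
noncomputable def G (n q : ℕ) : Submodule k (P k g n) :=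
  Submodule.span k {t | ∃ a w u, u ∈ PBW.Uf b q ∧ t = a ⊗ₜ[k] (w ⊗ₜ[k] u)}

lemma mem_G {n q} (a : UniversalEnvelopingAlgebra k g) (w : ⋀[k]^n g) {u} (hu : u ∈ PBW.Uf b q) :
    a ⊗ₜ[k] (w ⊗ₜ[k] u) ∈ G b n q := Submodule.subset_span ⟨a, w, u, hu, rfl⟩

lemma G_le {n q} (S : Submodule k (P k g n))
    (h : ∀ a w u, u ∈ PBW.Uf b q → a ⊗ₜ[k] (w ⊗ₜ[k] u) ∈ S) : G b n q ≤ S := by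
  apply Submodule.span_le.2
  rintro _ ⟨a, w, u, hu, rfl⟩
  exact h a w u hu

lemma G_map {n n' q q'} (f : P k g n →ₗ[k] P k g n')
    (h : ∀ a w u, u ∈ PBW.Uf b q → f (a ⊗ₜ[k] (w ⊗ₜ[k] u)) ∈ G b n' q') {z}
    (hz : z ∈ G b n q) : f z ∈ G b n' q' := by
  have := G_le b ((G b n' q').comap f) h hz
  exact this

lemma G_mono {n p q} (h : p ≤ q) : G b n p ≤ G b n q :=
  G_le b _ fun a w _ hu => mem_G b a w (PBW.Uf_mono b h hu)

lemma G_zero (n) : G b n 0 = ⊥ := by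
  rw [eq_bot_iff]
  apply G_le
  intro a w u hu
  rw [PBW.Uf_zero] at hu
  rw [(Submodule.mem_bot k).1 hu, TensorProduct.tmul_zero, TensorProduct.tmul_zero]
  exact Submodule.zero_mem _

lemma G_top (n) (z : P k g n) : ∃ q, z ∈ G b n q := by
  induction z using TensorProduct.induction_on with
  | zero => exact ⟨0, Submodule.zero_mem _⟩
  | add x y hx hy =>
    obtain ⟨p, hp⟩ := hx
    obtain ⟨q, hq⟩ := hy
    exact ⟨max p q, add_mem (G_mono b (le_max_left _ _) hp) (G_mono b (le_max_right _ _) hq)⟩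
  | tmul a t =>
    induction t using TensorProduct.induction_on with
    | zero => exact ⟨0, by rw [TensorProduct.tmul_zero]; exact Submodule.zero_mem _⟩
    | add x y hx hy =>
      obtain ⟨p, hp⟩ := hx
      obtain ⟨q, hq⟩ := hy
      refine ⟨max p q, ?_⟩
      rw [TensorProduct.tmul_add]
      exact add_mem (G_mono b (le_max_left _ _) hp) (G_mono b (le_max_right _ _) hq)
    | tmul w u =>
      obtain ⟨q, hq⟩ := PBW.exists_Uf b u
      exact ⟨q, mem_G b a w hq⟩

lemma G_span (n q) (S : Submodule k (P k g (n + 1)))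
    (h : ∀ x, ∀ z ∈ G b n q, E n x z ∈ S) : G b (n + 1) q ≤ S := by
  apply G_le
  intro a w u hu
  have hw : w ∈ Submodule.span k (Set.range (wedgePow k (n + 1) (g := g))) := by
    rw [span_wedgePow]; trivial
  have := Submodule.span_le (p := S.comap (TensorProduct.mk k (UniversalEnvelopingAlgebra k g) _ a ∘ₗ
    (TensorProduct.mk k (⋀[k]^(n + 1) g) (UniversalEnvelopingAlgebra k g)).flip u)) |>.2 (by
      rintro _ ⟨y, rfl⟩
      change a ⊗ₜ[k] (wedgePow k (n + 1) y ⊗ₜ[k] u) ∈ S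
      rw [wedgePow_succ, ← E_tmul]
      exact h _ _ (mem_G b a _ hu)) hw
  exact this

lemma L1_mem {n} (x : g) {q z} (hz : z ∈ G b n q) : L1 n x z ∈ G b n q :=
  G_map b _ (fun a w u hu => by
    rw [L1_tmul]
    exact sub_mem (mem_G b _ _ hu) (mem_G b _ _ hu)) hz

lemma Dl_mem {n} (i) {q z} (hz : z ∈ G b n (q + 1)) : Dl b n i z ∈ G b n q :=
  G_map b _ (fun a w u hu => by
    rw [Dl_tmul]
    exact mem_G b _ _ (PBW.D_mem b i hu)) hz

lemma Dl_L (n i) (x : g) (q z) (hz : z ∈ G b n (q + 1)) :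
    Dl b n i (L n x z) - L n x (Dl b n i z) - (b.repr x i) • z ∈ G b n q := by
  refine G_map b (Dl b n i ∘ₗ L n x - L n x ∘ₗ Dl b n i - (b.repr x i) • LinearMap.id) ?_ hz
  intro a w u hu
  have := mem_G b a w (PBW.D_comm b i x hu)
  convert this using 1
  simp only [LinearMap.sub_apply, LinearMap.comp_apply, LinearMap.smul_apply, LinearMap.id_apply,
    L_tmul, Dl_tmul, map_add, map_sub, sub_last, TensorProduct.tmul_smul]
  abel

lemma euler (n q z) (hz : z ∈ G b n (q + 1)) :
    ∑ i, L n (b i) (Dl b n i z) - (q : k) • z ∈ G b n q := by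
  have h1 : ∑ i, L1 n (b i) (Dl b n i z) ∈ G b n q :=
    sum_mem fun i _ => L1_mem b _ (Dl_mem b i hz)
  have h2 : ∑ i, L2 n (b i) (Dl b n i z) - (q : k) • z ∈ G b n q := by
    have := G_map b (n := n) (n' := n) (q := q + 1) (q' := q)
      (∑ i, L2 n (b i) ∘ₗ Dl b n i - (q : k) • LinearMap.id) (by
        intro a w u hu
        convert mem_G b a w (PBW.D_euler b hu) using 1
        simp only [LinearMap.sub_apply, LinearMap.sum_apply, LinearMap.comp_apply,
          LinearMap.smul_apply, LinearMap.id_apply, L2_tmul, Dl_tmul, sub_last,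
          TensorProduct.tmul_smul, TensorProduct.tmul_sum]) hz
    simpa only [LinearMap.sub_apply, LinearMap.sum_apply, LinearMap.comp_apply,
          LinearMap.smul_apply, LinearMap.id_apply] using this
  have := add_mem h1 h2
  convert this using 1
  simp only [L_apply, Finset.sum_add_distrib]
  abel

end filt

section diff
variable {d : ∀ n : ℕ, P k g (n + 1) →ₗ[k] P k g n}

/-- the formula for the differential -/
def IsDiff (d : ∀ n : ℕ, P k g (n + 1) →ₗ[k] P k g n) : Prop :=
  ∀ (n : ℕ) (x : Fin (n + 1) → g) (a b : UniversalEnvelopingAlgebra k g),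
      d n (a ⊗ₜ[k] (wedgePow k (n+1) x ⊗ₜ[k] b)) =
        (∑ i : Fin (n + 1), ((-1 : k) ^ (i : ℕ)) •
          ((a * UniversalEnvelopingAlgebra.ι k (x i)) ⊗ₜ[k]
              (wedgePow k n (x ∘ i.succAbove) ⊗ₜ[k] b)))
        + (∑ i : Fin (n + 1), ((-1 : k) ^ ((i : ℕ) + 1)) •
          (a ⊗ₜ[k] (wedgePow k n (x ∘ i.succAbove) ⊗ₜ[k]
              (UniversalEnvelopingAlgebra.ι k (x i) * b))))
        + ∑ j : Fin (n + 1), ∑ i : Fin (n + 1),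
            if h : i < j then
              ((-1 : k) ^ ((i : ℕ) + (j : ℕ))) •
                (a ⊗ₜ[k] (wedgePow k n (bvec x i j h) ⊗ₜ[k] b))
            else 0

lemma d_zero (hd : IsDiff d) (x : g) (z : P k g 0) : d 0 (E 0 x z) = - L 0 x z := by
  have : d 0 ∘ₗ E 0 x = - L 0 x := by
    apply ext_Pw
    intro a y u
    rw [LinearMap.comp_apply, E_tmul, wedgeL_wedgePow, hd, LinearMap.neg_apply, L_tmul, ad_zero]
    simp only [Fin.sum_univ_succ, Finset.univ_eq_empty, Finset.sum_empty, lt_irrefl, dite_false,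
      cons_succAbove_zero, Fin.cons_zero, Fin.val_zero, pow_zero, one_smul, zero_add, pow_one,
      TensorProduct.zero_tmul, TensorProduct.tmul_zero, add_zero, neg_smul_P]
    abel
  exact LinearMap.congr_fun this z

lemma d_succ (hd : IsDiff d) (n) (x : g) (z : P k g (n + 1)) :
    d (n + 1) (E (n + 1) x z) = - E n x (d n z) - L (n + 1) x z := by
  have : d (n + 1) ∘ₗ E (n + 1) x = - (E n x ∘ₗ d n) - L (n + 1) x := by
    apply ext_Pw
    intro a y u
    rw [LinearMap.comp_apply, E_tmul, wedgeL_wedgePow, hd, LinearMap.sub_apply,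
      LinearMap.neg_apply, LinearMap.comp_apply, hd, L_tmul]
    have h1 : (∑ i : Fin (n + 2), ((-1 : k) ^ (i : ℕ)) •
          ((a * UniversalEnvelopingAlgebra.ι k ((Fin.cons x y : Fin (n + 2) → g) i)) ⊗ₜ[k]
              (wedgePow k (n + 1) ((Fin.cons x y : Fin (n + 2) → g) ∘ i.succAbove) ⊗ₜ[k] u))) =
        (a * UniversalEnvelopingAlgebra.ι k x) ⊗ₜ[k] (wedgePow k (n + 1) y ⊗ₜ[k] u) -
        E n x (∑ i : Fin (n + 1), ((-1 : k) ^ (i : ℕ)) •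
          ((a * UniversalEnvelopingAlgebra.ι k (y i)) ⊗ₜ[k]
              (wedgePow k n (y ∘ i.succAbove) ⊗ₜ[k] u))) := by
      rw [Fin.sum_univ_succ, cons_succAbove_zero, Fin.cons_zero, Fin.val_zero, pow_zero, one_smul,
        sub_eq_add_neg, map_sum, ← Finset.sum_neg_distrib]
      congr 1
      refine Finset.sum_congr rfl fun i _ => ?_
      rw [cons_succAbove, Fin.cons_succ, ← wedgeL_wedgePow, map_smul, E_tmul, Fin.val_succ, pow_succ,
        mul_neg_one, neg_smul_P]
    have h2 : (∑ i : Fin (n + 2), ((-1 : k) ^ ((i : ℕ) + 1)) •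
          (a ⊗ₜ[k] (wedgePow k (n + 1) ((Fin.cons x y : Fin (n + 2) → g) ∘ i.succAbove) ⊗ₜ[k]
            (UniversalEnvelopingAlgebra.ι k ((Fin.cons x y : Fin (n + 2) → g) i) * u)))) =
        - (a ⊗ₜ[k] (wedgePow k (n + 1) y ⊗ₜ[k] (UniversalEnvelopingAlgebra.ι k x * u))) -
        E n x (∑ i : Fin (n + 1), ((-1 : k) ^ ((i : ℕ) + 1)) •
          (a ⊗ₜ[k] (wedgePow k n (y ∘ i.succAbove) ⊗ₜ[k]
            (UniversalEnvelopingAlgebra.ι k (y i) * u)))) := by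
      rw [Fin.sum_univ_succ, cons_succAbove_zero, Fin.cons_zero, Fin.val_zero, zero_add, pow_one,
        neg_smul_P, one_smul, sub_eq_add_neg, map_sum, ← Finset.sum_neg_distrib]
      congr 1
      refine Finset.sum_congr rfl fun i _ => ?_
      rw [cons_succAbove, Fin.cons_succ, ← wedgeL_wedgePow, map_smul, E_tmul, Fin.val_succ,
        pow_succ _ ((i : ℕ) + 1), mul_neg_one, neg_smul_P]
    have h3 : (∑ j : Fin (n + 2), ∑ i : Fin (n + 2),
            if h : i < j then
              ((-1 : k) ^ ((i : ℕ) + (j : ℕ))) •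
                (a ⊗ₜ[k] (wedgePow k (n + 1)
                  (bvec (Fin.cons x y : Fin (n + 2) → g) i j h) ⊗ₜ[k] u))
            else 0) =
        - (a ⊗ₜ[k] (ad (n + 1) x (wedgePow k (n + 1) y) ⊗ₜ[k] u)) -
        E n x (∑ j : Fin (n + 1), ∑ i : Fin (n + 1),
            if h : i < j then
              ((-1 : k) ^ ((i : ℕ) + (j : ℕ))) •
                (a ⊗ₜ[k] (wedgePow k n (bvec y i j h) ⊗ₜ[k] u))
            else 0) := by
      rw [Fin.sum_univ_succ, Finset.sum_eq_zero (s := Finset.univ), zero_add, ad_wedgePow, map_sum,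
        TensorProduct.sum_tmul, TensorProduct.tmul_sum, ← Finset.sum_neg_distrib, ← Finset.sum_sub_distrib]
      · refine Finset.sum_congr rfl fun j _ => ?_
        rw [Fin.sum_univ_succ, dif_pos (Fin.succ_pos j), bvec_zero, ← wedgeL_wedgePow, Fin.val_zero,
          zero_add, Fin.val_succ, pow_succ, mul_neg_one, map_sum, sub_eq_add_neg,
          ← Finset.sum_neg_distrib]
        congr 1
        · rw [neg_smul_P, ← TensorProduct.smul_tmul', TensorProduct.tmul_smul]
        · refine Finset.sum_congr rfl fun i _ => ?_
          by_cases h : i < j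
          · rw [dif_pos h, dif_pos (Fin.succ_lt_succ_iff.2 h), bvec_succ x y i j _ h, map_smul,
              E_tmul, neg_mid, smul_neg_P, Fin.val_succ]
            congr 2
            ring
          · rw [dif_neg h, dif_neg (fun h' => h (Fin.succ_lt_succ_iff.1 h')), map_zero, neg_zero]
      · intro i _
        exact dif_neg (Fin.not_lt_zero i)
    rw [h1, h2, h3]
    simp only [map_add]
    abel
  exact LinearMap.congr_fun this z

lemma data {m : ℕ} (b : Module.Basis (Fin m) k g) (hd : IsDiff d) :
    CEabs.Data k g b (P k g) d E L (Dl b) (G b) where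
  d_zero := d_zero hd
  d_succ := d_succ hd
  L_ε := L_E
  L_L := L_L
  G_span := G_span b
  G_top := G_top b
  G_zero := G_zero b
  ε_mem n x q z hz := G_map b (E n x) (fun a w _ hu => mem_G b a (wedgeL k n x w) hu) hz
  ε_ε := E_E
  Δ_ε n i y z := by
    have : Dl b (n + 1) i ∘ₗ E n y = E n y ∘ₗ Dl b n i := ext_P _ _ fun a w u => rfl
    exact LinearMap.congr_fun this z
  Δ_L := Dl_L b
  euler := euler b

lemma mem_G_one {m : ℕ} (b : Module.Basis (Fin m) k g) (z) (hz : z ∈ G b 0 1) :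
    ∃ a : UniversalEnvelopingAlgebra k g,
      z = a ⊗ₜ[k] (wedgePow k 0 (fun i : Fin 0 => i.elim0) ⊗ₜ[k] 1) := by
  have h := G_le b (LinearMap.range ((TensorProduct.mk k (UniversalEnvelopingAlgebra k g)
    ((⋀[k]^0 g) ⊗[k] UniversalEnvelopingAlgebra k g)).flip
      (wedgePow k 0 (fun i : Fin 0 => i.elim0) ⊗ₜ[k] 1))) (by
    intro a w u hu
    obtain ⟨r, rfl⟩ := PBW.Uf_one b hu
    obtain ⟨s, rfl⟩ := span_zero w (fun i => i.elim0)
    refine ⟨(r * s) • a, ?_⟩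
    simp only [LinearMap.flip_apply, TensorProduct.mk_apply, TensorProduct.tmul_smul,
      ← TensorProduct.smul_tmul', smul_smul]) hz
  obtain ⟨a, ha⟩ := h
  exact ⟨a, ha.symm⟩

end diff
end CEc

/-- For a finite-dimensional Lie algebra `g` over a field `k` of
characteristic zero, `A = U(g)`, the complex `P_n = A ⊗ Λⁿg ⊗ A` with the
Koszul–Chevalley–Eilenberg differential (including the Lie-bracket term) is a
resolution of `A` as an `A`-bimodule: the multiplication map `μ : P₀ → A` is
surjective, `H₀(P_•) = A` (exactness of `P₁ → P₀ → A → 0`), and `Hₙ(P_•) = 0` for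
`n > 0` (exactness at every `P_{n+1}`). -/
theorem koszul_CE_resolution_of_UEA
    (k g : Type*) [Field k] [CharZero k] [LieRing g] [LieAlgebra k g]
    [Module.Finite k g]
    (d : ∀ n : ℕ,
      (UniversalEnvelopingAlgebra k g ⊗[k]
        ((⋀[k]^(n+1) g) ⊗[k] UniversalEnvelopingAlgebra k g)) →ₗ[k]
      (UniversalEnvelopingAlgebra k g ⊗[k]
        ((⋀[k]^n g) ⊗[k] UniversalEnvelopingAlgebra k g)))
    (μ : (UniversalEnvelopingAlgebra k g ⊗[k]
        ((⋀[k]^0 g) ⊗[k] UniversalEnvelopingAlgebra k g)) →ₗ[k]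
      UniversalEnvelopingAlgebra k g)
    -- μ is the multiplication map a ⊗ 1 ⊗ b ↦ ab
    (hμ : ∀ a b : UniversalEnvelopingAlgebra k g,
      μ (a ⊗ₜ[k] (wedgePow k 0 (fun i : Fin 0 => i.elim0) ⊗ₜ[k] b)) = a * b)
    -- d is the Koszul–Chevalley–Eilenberg differential
    (hd : ∀ (n : ℕ) (x : Fin (n + 1) → g) (a b : UniversalEnvelopingAlgebra k g),
      d n (a ⊗ₜ[k] (wedgePow k (n+1) x ⊗ₜ[k] b)) =
        (∑ i : Fin (n + 1), ((-1 : k) ^ (i : ℕ)) •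
          ((a * UniversalEnvelopingAlgebra.ι k (x i)) ⊗ₜ[k]
              (wedgePow k n (x ∘ i.succAbove) ⊗ₜ[k] b)))
        + (∑ i : Fin (n + 1), ((-1 : k) ^ ((i : ℕ) + 1)) •
          (a ⊗ₜ[k] (wedgePow k n (x ∘ i.succAbove) ⊗ₜ[k]
              (UniversalEnvelopingAlgebra.ι k (x i) * b))))
        + ∑ j : Fin (n + 1), ∑ i : Fin (n + 1),
            if h : i < j then
              ((-1 : k) ^ ((i : ℕ) + (j : ℕ))) •
                (a ⊗ₜ[k] (wedgePow k n
                  (fun m : Fin n =>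
                    if hm : (m : ℕ) = 0 then ⁅x i, x j⁆
                    else x ⟨if (m : ℕ) - 1 < (i : ℕ) then (m : ℕ) - 1
                            else if (m : ℕ) < (j : ℕ) then (m : ℕ)
                            else (m : ℕ) + 1,
                          by
                            have h' : (i : ℕ) < (j : ℕ) := h
                            have := j.isLt
                            have := m.isLt
                            split <;> [omega; skip]
                            split <;> omega⟩) ⊗ₜ[k] b))
            else 0) :
    Function.Surjective μ ∧
    Function.Exact (d 0) μ ∧
    (∀ n : ℕ, Function.Exact (d (n + 1)) (d n)) := by

  have hd' : CEc.IsDiff d := hd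
  let b := Module.finBasis k g
  have H := CEc.data b hd'
  have hμd : ∀ z, μ (d 0 z) = 0 := by
    intro z
    refine CEabs.ext_ε H 0 (μ ∘ₗ d 0) 0 ?_ z
    intro x z
    have : (μ ∘ₗ d 0) ∘ₗ CEc.E 0 x = 0 := by
      apply CEc.ext_Pw
      intro a y u
      obtain rfl : y = fun i => i.elim0 := Subsingleton.elim _ _
      rw [LinearMap.comp_apply, LinearMap.comp_apply, H.d_zero, CEc.L_tmul, CEext.ad_zero,
        TensorProduct.zero_tmul, TensorProduct.tmul_zero, map_neg, map_add, map_sub, hμ, hμ,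
        map_zero, mul_assoc]
      simp
    exact LinearMap.congr_fun this z
  refine ⟨fun a => ⟨_, (hμ a 1).trans (mul_one a)⟩, ?_, fun n => CEabs.exact_succ H n⟩
  intro z
  constructor
  · intro hz
    obtain ⟨q, hq⟩ := CEc.G_top b 0 z
    obtain ⟨w, hw⟩ := CEabs.reduce_zero H q z (CEc.G_mono b (Nat.le_succ q) hq)
    obtain ⟨a, ha⟩ := CEc.mem_G_one b _ hw
    have h0 : a = 0 := by
      have := congrArg μ ha
      rw [hμ, mul_one, map_sub, hz, hμd, sub_zero] at this
      exact this.symm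
    rw [h0, TensorProduct.zero_tmul] at ha
    exact ⟨w, (sub_eq_zero.1 ha).symm⟩
  · rintro ⟨w, rfl⟩
    exact hμd w
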